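/- Uniqueness of minimal dimension: if a 0/1-valued function f on Σ* is realized by some transition tuple, then the minimal dimension of a realizing transition tuple equals the rank of the (infinite) Hankel matrix H_f, restricted to the statement: for any finite Ψ, Γ giving a sub-Hankel matrix of rank r, any realizing transition tuple has dimension at least r. -/

import Mathlib

open Matrix

/-- For any 0/1-valued function `f` on `Σ*` realized by a transition
tuple of dimension `n`, the rank of any finite sub-Hankel matrix of `f` (indexed by
finite sets of prefixes and suffixes, with entries `f(ψγ)`) is at most `n`; i.e. the
rank of any finite Hankel matrix is a lower bound on the dimension of any realizing
transition tuple. -/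
theorem stmt_15 {n a b : ℕ} {A : Type*}
    (f : List A → ℝ) (hf01 : ∀ w, f w = 0 ∨ f w = 1)
    (t0 tinf : Fin n → ℝ) (T : A → Matrix (Fin n) (Fin n) ℝ)
    (hrealize : ∀ w : List A, f w = Matrix.vecMul t0 ((w.map T).prod) ⬝ᵥ tinf)
    (ψ : Fin a → List A) (γ : Fin b → List A)
    (H : Matrix (Fin a) (Fin b) ℝ)
    (hH : ∀ i j, H i j = f (ψ i ++ γ j)) :
    H.rank ≤ n := by
  -- Factor `H = P * S` through dimension `n`.
  let P : Matrix (Fin a) (Fin n) ℝ := Matrix.of fun i => t0 ᵥ* ((ψ i).map T).prod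
  let S : Matrix (Fin n) (Fin b) ℝ := Matrix.of fun k j => (((γ j).map T).prod *ᵥ tinf) k
  have hfac : H = P * S := by
    ext i j
    rw [hH, hrealize, List.map_append, List.prod_append, ← Matrix.vecMul_vecMul,
      ← Matrix.dotProduct_mulVec]
    rfl
  rw [hfac]
  exact (Matrix.rank_mul_le_left P S).trans (Matrix.rank_le_width P)
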